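/- Let N ≥ 1 be an integer and let λ, η > 0. Let p_Q(q) = (Γ((λ+N)/2)/(Γ(λ/2)Γ(N/2))) (λ/η)^{λ/2} q^{N/2−1} (λ/η+q)^{−(λ+N)/2} and ψ₀(t) = −(λ+N) / (2(λ/η + t)). Then ∫₀^∞ q² · ψ₀(q)² · p_Q(q) dq = N (N + 2) (λ + N) / (4 (N + λ + 2)). -/

import Mathlib

open MeasureTheory Set Real

/-- The real Beta integral on the unit interval. -/
lemma integral_Ioo_rpow_mul_one_sub_rpow {a b : ℝ} (ha : 0 < a) (hb : 0 < b) :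
    ∫ x in Ioo (0 : ℝ) 1, x ^ (a - 1) * (1 - x) ^ (b - 1) = ProbabilityTheory.beta a b := by
  rw [ProbabilityTheory.beta_eq_betaIntegralReal a b ha hb, Complex.betaIntegral,
    intervalIntegral.integral_of_le (by norm_num),
    ← integral_Ioc_eq_integral_Ioo, ← RCLike.re_to_complex, ← integral_re]
  · refine setIntegral_congr_fun measurableSet_Ioc fun x ⟨hx1, hx2⟩ ↦ ?_
    norm_cast
    rw [← Complex.ofReal_cpow, ← Complex.ofReal_cpow, RCLike.re_to_complex,
      Complex.re_mul_ofReal, Complex.ofReal_re]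
    all_goals linarith
  · rw [← IntegrableOn, ← intervalIntegrable_iff_integrableOn_Ioc_of_le zero_le_one]
    exact Complex.betaIntegral_convergent (by simpa) (by simpa)

lemma image_div_add_Ioi {c : ℝ} (hc : 0 < c) :
    (fun q : ℝ => q / (c + q)) '' Ioi 0 = Ioo 0 1 := by
  ext x
  simp only [mem_image, mem_Ioi, mem_Ioo]
  constructor
  · rintro ⟨q, hq, rfl⟩
    exact ⟨by positivity, (div_lt_one (by positivity)).2 (by linarith)⟩
  · rintro ⟨h0, h1⟩
    have h : 0 < 1 - x := by linarith
    refine ⟨c * x / (1 - x), by positivity, ?_⟩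
    field_simp
    ring

/-- The Beta integral on the half-line, with a scale parameter. -/
lemma integral_Ioi_rpow_mul_add_rpow {a b c : ℝ} (ha : 0 < a) (hb : 0 < b) (hc : 0 < c) :
    ∫ q in Ioi (0 : ℝ), q ^ (a - 1) * (c + q) ^ (-(a + b)) =
      c ^ (-b) * ProbabilityTheory.beta a b := by
  have hderiv : ∀ q ∈ Ioi (0 : ℝ),
      HasDerivWithinAt (fun q : ℝ => q / (c + q)) (c / (c + q) ^ 2) (Ioi 0) q := by
    intro q hq
    have hq' : c + q ≠ 0 := (add_pos hc hq).ne'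
    have h := (((hasDerivAt_id' q).fun_div ((hasDerivAt_id' q).const_add c)
      hq').hasDerivWithinAt (s := Ioi 0))
    rwa [one_mul, mul_one, add_sub_cancel_right] at h
  have hinj : InjOn (fun q : ℝ => q / (c + q)) (Ioi 0) := by
    intro p hp q hq h
    have hp' : c + p ≠ 0 := (add_pos hc hp).ne'
    have hq' : c + q ≠ 0 := (add_pos hc hq).ne'
    have h' : p * (c + q) = q * (c + p) := (div_eq_div_iff hp' hq').1 h
    exact mul_left_cancel₀ hc.ne' (by linarith)
  rw [← integral_Ioo_rpow_mul_one_sub_rpow ha hb, ← image_div_add_Ioi hc,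
    integral_image_eq_integral_abs_deriv_smul measurableSet_Ioi hderiv hinj,
    ← integral_const_mul]
  refine setIntegral_congr_fun measurableSet_Ioi fun q hq => ?_
  have hq0 : 0 < q := hq
  have hs : 0 < c + q := add_pos hc hq0
  have h1 : 1 - q / (c + q) = c / (c + q) := by field_simp; ring
  simp only [smul_eq_mul]
  rw [h1, abs_of_pos (by positivity), div_rpow hq0.le hs.le, div_rpow hc.le hs.le,
    show -(a + b) = -((a - 1) + (b - 1) + (2 : ℕ)) by push_cast; ring,
    rpow_neg hs.le, rpow_add_natCast hs.ne', rpow_add hs, rpow_neg hc.le,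
    rpow_sub_one hc.ne' b]
  have := (rpow_pos_of_pos hc b).ne'
  have := (rpow_pos_of_pos hs (a - 1)).ne'
  have := (rpow_pos_of_pos hs (b - 1)).ne'
  field_simp

/-- for the t-distribution with shape `λ = lam` and scale `η`,
`E{Q² ψ₀(Q)²} = ∫₀^∞ q² ψ₀(q)² p_Q(q) dq = N(N+2)(λ+N) / (4(N+λ+2))`. -/
theorem stmt_18 (N : ℕ) (hN : 1 ≤ N) (lam η : ℝ) (hlam : 0 < lam) (hη : 0 < η)
    (pQ : ℝ → ℝ)
    (hpQ : pQ = fun q =>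
      Real.Gamma ((lam + N) / 2) / (Real.Gamma (lam / 2) * Real.Gamma ((N : ℝ) / 2)) *
        (lam / η) ^ (lam / 2) * q ^ ((N : ℝ) / 2 - 1) * (lam / η + q) ^ (-(lam + N) / 2))
    (ψ₀ : ℝ → ℝ) (hψ₀ : ψ₀ = fun t => -(lam + N) / (2 * (lam / η + t))) :
    (∫ q in Ioi (0 : ℝ), q ^ 2 * ψ₀ q ^ 2 * pQ q) =
      N * (N + 2) * (lam + N) / (4 * (N + lam + 2)) := by
  subst hpQ hψ₀
  have hN0 : (0 : ℝ) < N := by exact_mod_cast hN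
  have hc : 0 < lam / η := by positivity
  set c := lam / η
  set C := Real.Gamma ((lam + N) / 2) / (Real.Gamma (lam / 2) * Real.Gamma ((N : ℝ) / 2))
    with hC
  have hcongr : ∀ q ∈ Ioi (0 : ℝ),
      q ^ 2 * (-(lam + N) / (2 * (c + q))) ^ 2 *
        (C * c ^ (lam / 2) * q ^ ((N : ℝ) / 2 - 1) * (c + q) ^ (-(lam + N) / 2)) =
      (lam + N) ^ 2 / 4 * C * c ^ (lam / 2) *
        (q ^ ((N : ℝ) / 2 + 2 - 1) * (c + q) ^ (-((N : ℝ) / 2 + 2 + lam / 2))) := by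
    intro q hq
    have hq0 : 0 < q := hq
    have hs : 0 < c + q := add_pos hc hq0
    rw [show (N : ℝ) / 2 + 2 - 1 = (N : ℝ) / 2 - 1 + (2 : ℕ) by push_cast; ring,
      show -((N : ℝ) / 2 + 2 + lam / 2) = -(lam + N) / 2 - (2 : ℕ) by push_cast; ring,
      rpow_add_natCast hq0.ne', rpow_sub_natCast hs.ne']
    field_simp
    ring
  have hg1 : Real.Gamma ((N : ℝ) / 2 + 2) =
      ((N : ℝ) / 2 + 1) * ((N : ℝ) / 2 * Real.Gamma ((N : ℝ) / 2)) := by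
    rw [← Real.Gamma_add_one (by positivity), ← Real.Gamma_add_one (by positivity)]
    ring_nf
  have hg2 : Real.Gamma ((N : ℝ) / 2 + 2 + lam / 2) =
      ((lam + N) / 2 + 1) * ((lam + N) / 2 * Real.Gamma ((lam + N) / 2)) := by
    rw [← Real.Gamma_add_one (by positivity), ← Real.Gamma_add_one (by positivity)]
    ring_nf
  rw [setIntegral_congr_fun measurableSet_Ioi hcongr, integral_const_mul,
    integral_Ioi_rpow_mul_add_rpow (by positivity) (by positivity) hc,
    ProbabilityTheory.beta, hg1, hg2, hC, rpow_neg hc.le]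
  have h1 := (Real.Gamma_pos_of_pos (show 0 < (N : ℝ) / 2 by positivity)).ne'
  have h2 := (Real.Gamma_pos_of_pos (show 0 < lam / 2 by positivity)).ne'
  have h3 := (Real.Gamma_pos_of_pos (show 0 < (lam + N) / 2 by positivity)).ne'
  have h4 := (rpow_pos_of_pos hc (lam / 2)).ne'
  have h5 : (N : ℝ) + lam + 2 ≠ 0 := by positivity
  have h6 : lam + N + 2 ≠ 0 := by positivity
  field_simp
  ring
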